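/- arXiv:0801.3883 — 5 statements merged into one kernel-verified Lean document; each statement's English description precedes it below -/
import Mathlib

section
/- Let u : ℝ³ → ℝ³ be a Schwartz vector field and let g : ℝ → ℝ be continuously differentiable. Then ∫_{ℝ³} ⟨Δu(x), g(|u(x)|²) u(x)⟩ dx = −∫_{ℝ³} g(|u(x)|²) |∇u(x)|² dx − ½ ∫_{ℝ³} g′(|u(x)|²) |∇(|u|²)(x)|² dx, where Δu is the componentwise Laplacian, |∇u|² = ∑_{i,k=1}^3 (∂_{x_i} u_k)² and ∇(|u|²) is the gradient of x ↦ |u(x)|². (This is the integration-by-parts identity underlying the estimate of −⟨u, P(g_N(|u|²)u)⟩₁ in the proof of Lemma 6.3.) -/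
open MeasureTheory

open SchwartzMap LineDeriv in
/-- Integration by parts for a Schwartz function against a differentiable weight times a Schwartz
function, the weight and its derivative being bounded and continuous. -/
theorem SchwartzMap.integral_lineDeriv_lineDeriv_mul {E : Type*} [NormedAddCommGroup E]
    [NormedSpace ℝ E] [FiniteDimensional ℝ E] [MeasurableSpace E] [BorelSpace E]
    (μ : Measure E) [μ.IsAddHaarMeasure] (w : 𝓢(E, ℝ)) (v : E)
    (G H : BoundedContinuousFunction E ℝ) (hG : Differentiable ℝ G)
    (hH : ∀ x, fderiv ℝ G x v = H x) :
    Integrable (fun x => ∂_{v} (∂_{v} w) x * (G x * w x)) μ ∧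
    Integrable (fun x => G x * (∂_{v} w x) ^ 2) μ ∧
    Integrable (fun x => H x * (w x * ∂_{v} w x)) μ ∧
    ∫ x, ∂_{v} (∂_{v} w) x * (G x * w x) ∂μ =
      -(∫ x, G x * (∂_{v} w x) ^ 2 ∂μ + ∫ x, H x * (w x * ∂_{v} w x) ∂μ) := by
  have key (K : BoundedContinuousFunction E ℝ) (f : 𝓢(E, ℝ)) :
      Integrable (fun x => K x * f x) μ :=
    f.integrable.bdd_mul K.continuous.aestronglyMeasurable (.of_forall K.norm_coe_le_norm)
  have key2 (K : BoundedContinuousFunction E ℝ) (f h : 𝓢(E, ℝ)) :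
      Integrable (fun x => K x * (f x * h x)) μ := by
    simpa [mul_assoc] using key (K * f.toBoundedContinuousFunction) h
  have h1 := key2 G (∂_{v} (∂_{v} w)) w
  have h2 := key2 G (∂_{v} w) (∂_{v} w)
  have h3 := key2 H w (∂_{v} w)
  have hd (x : E) : fderiv ℝ (fun y => G y * w y) x v = G x * ∂_{v} w x + H x * w x := by
    rw [fderiv_fun_mul (hG x) w.differentiableAt]
    simp [hH, lineDerivOp_apply_eq_fderiv, mul_comm]
  have e2 : (fun x => G x * (∂_{v} w x * ∂_{v} w x)) = fun x => G x * (∂_{v} w x) ^ 2 := by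
    simp [pow_two]
  have e1 : (fun x => G x * (∂_{v} (∂_{v} w) x * w x)) =
      fun x => ∂_{v} (∂_{v} w) x * (G x * w x) := by
    ext x; ring
  rw [e1] at h1
  rw [e2] at h2
  refine ⟨h1, h2, h3, ?_⟩
  have e3 (x : E) : fderiv ℝ (fun y => G y * w y) x v * ∂_{v} w x =
      G x * (∂_{v} w x) ^ 2 + H x * (w x * ∂_{v} w x) := by
    rw [hd]; ring
  have ibp := integral_mul_fderiv_eq_neg_fderiv_mul_of_integrable (μ := μ) (v := v)
    (f := fun x => G x * w x) (g := ⇑(∂_{v} w : 𝓢(E, ℝ))) ?_ ?_ ?_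
    (fun x _ => (hG x).mul w.differentiableAt) (fun x _ => (∂_{v} w : 𝓢(E, ℝ)).differentiableAt)
  · rw [← integral_add h2 h3]
    simp only [← e3]
    rw [← ibp]
    congr 1 with x
    rw [mul_comm, ← lineDerivOp_apply_eq_fderiv]
  · simp only [e3]
    exact h2.add h3
  · simp only [← lineDerivOp_apply_eq_fderiv, mul_comm _ (∂_{v} (∂_{v} w) _)]
    exact h1
  · simpa only [mul_assoc] using key2 G w (∂_{v} w)

/-- A continuous function of a bounded continuous real function is bounded and continuous. -/
theorem BoundedContinuousFunction.exists_eq_comp {X : Type*} [TopologicalSpace X]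
    (R : BoundedContinuousFunction X ℝ) {h : ℝ → ℝ} (hh : Continuous h) :
    ∃ G : BoundedContinuousFunction X ℝ, ∀ x, G x = h (R x) := by
  obtain ⟨C, hC⟩ := (isCompact_closedBall (0 : ℝ) ‖R‖).exists_bound_of_continuousOn
    hh.continuousOn
  exact ⟨.ofNormedAddCommGroup (fun x => h (R x)) (hh.comp R.continuous) C
    fun x => hC _ (by simpa using R.norm_coe_le_norm x), fun _ => rfl⟩

/-- Integration-by-parts identity underlying the estimate of `−⟨u, P(g_N(|u|²)u)⟩₁`
in the proof of Lemma 6.3: for a Schwartz vector field `u : ℝ³ → ℝ³` and `g ∈ C¹(ℝ)`,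
`∫ ⟨Δu, g(|u|²)u⟩ dx = −∫ g(|u|²)|∇u|² dx − ½ ∫ g′(|u|²)|∇(|u|²)|² dx`. -/
theorem stmt5 (u : Fin 3 → SchwartzMap (EuclideanSpace ℝ (Fin 3)) ℝ)
    (g : ℝ → ℝ) (hg : ContDiff ℝ 1 g) :
    (∫ x, ∑ k,
        (∑ i, fderiv ℝ (fun y => fderiv ℝ (fun z => u k z) y (EuclideanSpace.single i 1)) x
            (EuclideanSpace.single i 1)) *
          (g (∑ j, (u j x) ^ 2) * u k x)) =
      -(∫ x, g (∑ j, (u j x) ^ 2) *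
          ∑ i, ∑ k, (fderiv ℝ (fun z => u k z) x (EuclideanSpace.single i 1)) ^ 2) -
      (1 / 2) * ∫ x, deriv g (∑ j, (u j x) ^ 2) *
          ∑ i, (fderiv ℝ (fun z => ∑ j, (u j z) ^ 2) x (EuclideanSpace.single i 1)) ^ 2 := by
  let e (i : Fin 3) : EuclideanSpace ℝ (Fin 3) := EuclideanSpace.single i 1
  let D (i k : Fin 3) := LineDeriv.lineDerivOp (e i) (u k)
  let R : BoundedContinuousFunction (EuclideanSpace ℝ (Fin 3)) ℝ :=
    ∑ j, (u j).toBoundedContinuousFunction ^ 2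
  let S (i : Fin 3) : BoundedContinuousFunction (EuclideanSpace ℝ (Fin 3)) ℝ :=
    2 • ∑ j, (u j).toBoundedContinuousFunction * (D i j).toBoundedContinuousFunction
  have hR (x) : R x = ∑ j, (u j x) ^ 2 := by simp [R]
  have hS (i x) : S i x = 2 * ∑ j, u j x * D i j x := by simp [S]
  have hD (i k x) : fderiv ℝ (fun z => u k z) x (EuclideanSpace.single i 1) = D i k x :=
    (SchwartzMap.lineDerivOp_apply_eq_fderiv (e i) (u k) x).symm
  have hDD (i k x) : fderiv ℝ (fun z => D i k z) x (EuclideanSpace.single i 1) =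
      LineDeriv.lineDerivOp (e i) (D i k) x :=
    (SchwartzMap.lineDerivOp_apply_eq_fderiv (e i) (D i k) x).symm
  have hRdiff : Differentiable ℝ (fun z => ∑ j, (u j z) ^ 2) := fun x =>
    DifferentiableAt.fun_sum fun j _ => (u j).differentiableAt.fun_pow 2
  have hRS (i x) : fderiv ℝ (fun z => ∑ j, (u j z) ^ 2) x (EuclideanSpace.single i 1) =
      S i x := by
    rw [fderiv_fun_sum fun j _ => (u j).differentiableAt.fun_pow 2, hS, Finset.mul_sum,
      sum_apply]
    refine Finset.sum_congr rfl fun j _ => ?_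
    rw [fderiv_fun_pow 2 (u j).differentiableAt, ← hD]
    simp [mul_assoc]
  obtain ⟨G, hG⟩ := R.exists_eq_comp hg.continuous
  obtain ⟨G', hG'⟩ := R.exists_eq_comp (hg.continuous_deriv le_rfl)
  have hGfun : (G : EuclideanSpace ℝ (Fin 3) → ℝ) = g ∘ fun z => ∑ j, (u j z) ^ 2 := by
    ext x; simp [hG, hR]
  have hgdiff : Differentiable ℝ g := hg.differentiable one_ne_zero
  have hGdiff : Differentiable ℝ G := hGfun ▸ hgdiff.comp hRdiff
  have hGderiv (i x) : fderiv ℝ G x (e i) = (G' * S i) x := by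
    rw [hGfun, fderiv_comp x (hgdiff _) (hRdiff x)]
    simp only [ContinuousLinearMap.comp_apply, e, hRS]
    simp [hG', hR, mul_comm]
  have main (i k : Fin 3) :=
    SchwartzMap.integral_lineDeriv_lineDeriv_mul volume (u k) (e i) G (G' * S i)
    hGdiff (hGderiv i)
  simp only [hD, hDD, hRS]
  simp only [← hR, ← hG, ← hG']
  have eB (x) : G' x * ∑ i, S i x ^ 2 = 2 * ∑ i, ∑ k, (G' * S i) x * (u k x * D i k x) := by
    simp only [Finset.mul_sum, BoundedContinuousFunction.mul_apply]
    refine Finset.sum_congr rfl fun i _ => ?_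
    simp only [← Finset.mul_sum]
    linear_combination G' x * S i x * hS i x
  have I1 (i k) := (main i k).1
  have I2 (i k) := (main i k).2.1
  have I3 (i k) := (main i k).2.2.1
  have IBP (i k) := (main i k).2.2.2
  have L : ∫ x, ∑ k, (∑ i, (LineDeriv.lineDerivOp (e i) (D i k)) x) * (G x * u k x) =
      ∑ i, ∑ k, ∫ x, (LineDeriv.lineDerivOp (e i) (D i k)) x * (G x * u k x) := by
    simp only [Finset.sum_mul]
    rw [integral_finsetSum _ fun k _ => integrable_finsetSum _ fun i _ => I1 i k,
      Finset.sum_comm]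
    exact Finset.sum_congr rfl fun k _ => integral_finsetSum _ fun i _ => I1 i k
  have M : ∫ x, G x * ∑ i, ∑ k, D i k x ^ 2 = ∑ i, ∑ k, ∫ x, G x * D i k x ^ 2 := by
    simp only [Finset.mul_sum]
    rw [integral_finsetSum _ fun i _ => integrable_finsetSum _ fun k _ => I2 i k]
    exact Finset.sum_congr rfl fun i _ => integral_finsetSum _ fun k _ => I2 i k
  have N : ∫ x, ∑ i, ∑ k, (G' * S i) x * (u k x * D i k x) =
      ∑ i, ∑ k, ∫ x, (G' * S i) x * (u k x * D i k x) := by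
    rw [integral_finsetSum _ fun i _ => integrable_finsetSum _ fun k _ => I3 i k]
    exact Finset.sum_congr rfl fun i _ => integral_finsetSum _ fun k _ => I3 i k
  simp only [eB, integral_const_mul]
  rw [L, M, N, Finset.sum_congr rfl fun i _ => Finset.sum_congr rfl fun k _ => IBP i k]
  simp only [Finset.sum_neg_distrib, Finset.sum_add_distrib]
  ring
end

section
/- Let N > 0, let u : ℝ³ → ℝ³ be a Schwartz vector field, and let g : ℝ → ℝ be continuously differentiable with g′(r) ≥ 0 for all r and g(r) ≥ r − N for all r ≥ 0. Then ∫_{ℝ³} ⟨Δu(x), g(|u(x)|²) u(x)⟩ dx ≤ −∫_{ℝ³} |u(x)|² |∇u(x)|² dx + N ∫_{ℝ³} |∇u(x)|² dx. (This is the key taming estimate −⟨∇u, ∇(g_N(|u|²)u)⟩₀ ≤ −∫ |∇u|²|u|² dx + N‖∇u‖₀² from the proof of Lemma 6.3; the taming function g_N of (6.4) satisfies these hypotheses.) -/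
open MeasureTheory

open scoped LineDeriv SchwartzMap BoundedContinuousFunction

namespace SchwartzMap

variable {E : Type*} [NormedAddCommGroup E] [NormedSpace ℝ E]

/-- A continuous function of `|u|²` is bounded and continuous. -/
lemma exists_boundedContinuousFunction_comp_sum_sq {ι : Type*} [Fintype ι]
    (u : ι → 𝓢(E, ℝ)) {φ : ℝ → ℝ} (hφ : Continuous φ) :
    ∃ H : E →ᵇ ℝ, ∀ x, H x = φ (∑ j, u j x ^ 2) := by
  let R : E →ᵇ ℝ := ∑ j, (u j).toBoundedContinuousFunction ^ 2
  have hR : ∀ x, R x = ∑ j, u j x ^ 2 := fun x => by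
    simp [R, SchwartzMap.toBoundedContinuousFunction]
  obtain ⟨C, hC⟩ := (isCompact_closedBall (0 : ℝ) ‖R‖).exists_bound_of_continuousOn
    hφ.continuousOn
  refine ⟨.ofNormedAddCommGroup (fun x => φ (R x)) (hφ.comp R.continuous) C fun x =>
    hC _ ?_, fun x => by simp [hR]⟩
  simpa using R.norm_coe_le_norm x

variable [MeasurableSpace E] [BorelSpace E] [FiniteDimensional ℝ E] {μ : Measure E}
  [μ.IsAddHaarMeasure]

lemma integrable_mul_boundedContinuousFunction (f : 𝓢(E, ℝ))
    (h : E →ᵇ ℝ) : Integrable (fun x => f x * h x) μ :=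
  f.integrable.mul_bdd (c := ‖h‖) h.continuous.aestronglyMeasurable
    (Filter.Eventually.of_forall h.norm_coe_le_norm)

/-- Integration by parts for `∂ᵢᵢ uₖ` tested against `g(|u|²) uₖ`. -/
lemma integral_fderiv_fderiv_mul_comp_sum_sq_mul {ι : Type*} [Fintype ι]
    (u : ι → 𝓢(E, ℝ)) {g : ℝ → ℝ} (hg : ContDiff ℝ 1 g)
    (k : ι) (v : E) :
    Integrable (fun x => fderiv ℝ (fun y => fderiv ℝ (u k) y v) x v *
        (g (∑ j, u j x ^ 2) * u k x)) μ ∧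
    Integrable (fun x => fderiv ℝ (u k) x v *
        (deriv g (∑ j, u j x ^ 2) * (2 * ∑ j, u j x * fderiv ℝ (u j) x v) * u k x +
          g (∑ j, u j x ^ 2) * fderiv ℝ (u k) x v)) μ ∧
    ∫ x, fderiv ℝ (fun y => fderiv ℝ (u k) y v) x v * (g (∑ j, u j x ^ 2) * u k x) ∂μ =
      -∫ x, fderiv ℝ (u k) x v *
        (deriv g (∑ j, u j x ^ 2) * (2 * ∑ j, u j x * fderiv ℝ (u j) x v) * u k x +
          g (∑ j, u j x ^ 2) * fderiv ℝ (u k) x v) ∂μ := by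
  have hD : ∀ (j : ι) x, (∂_{v} (u j)) x = fderiv ℝ (u j) x v := fun j x =>
    lineDerivOp_apply_eq_fderiv v (u j) x
  have hDD : ∀ x, (∂_{v} (∂_{v} (u k))) x = fderiv ℝ (fun y => fderiv ℝ (u k) y v) x v := by
    intro x
    rw [lineDerivOp_apply_eq_fderiv]
    simp_rw [← hD]
  obtain ⟨G, hG⟩ := exists_boundedContinuousFunction_comp_sum_sq u hg.continuous
  obtain ⟨G', hG'⟩ := exists_boundedContinuousFunction_comp_sum_sq u hg.continuous_deriv_one
  let U : ι → E →ᵇ ℝ := fun j => (u j).toBoundedContinuousFunction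
  let V : ι → E →ᵇ ℝ := fun j =>
    (∂_{v} (u j) : 𝓢(E, ℝ)).toBoundedContinuousFunction
  have hU : ∀ j x, U j x = u j x := fun j x => rfl
  have hV : ∀ j x, V j x = fderiv ℝ (u j) x v := fun j x => hD j x
  have h1 := integrable_mul_boundedContinuousFunction (μ := μ) (∂_{v} (∂_{v} (u k))) (G * U k)
  have h2 := integrable_mul_boundedContinuousFunction (μ := μ) (∂_{v} (u k))
    (G' * ((2 : ℝ) • ∑ j, U j * V j) * U k + G * V k)
  have h3 := integrable_mul_boundedContinuousFunction (μ := μ) (∂_{v} (u k)) (G * U k)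
  simp only [BoundedContinuousFunction.coe_mul, BoundedContinuousFunction.coe_add,
    BoundedContinuousFunction.coe_smul, BoundedContinuousFunction.coe_sum, Pi.mul_apply,
    Pi.add_apply, Finset.sum_apply, smul_eq_mul, hU, hV, hG, hG', hD, hDD] at h1 h2 h3
  have hF : ∀ x, HasFDerivAt (fun x => g (∑ j, u j x ^ 2) * u k x)
      (g (∑ j, u j x ^ 2) • fderiv ℝ (u k) x + u k x •
        (deriv g (∑ j, u j x ^ 2) • ∑ j, (2 * u j x) • fderiv ℝ (u j) x)) x := by
    intro x
    have hs : HasFDerivAt (fun x => ∑ j, u j x ^ 2) (∑ j, (2 * u j x) • fderiv ℝ (u j) x) x := by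
      refine HasFDerivAt.fun_sum fun j _ => ?_
      simpa using ((u j).hasFDerivAt x).pow 2
    exact (((hg.differentiable one_ne_zero).differentiableAt.hasDerivAt).comp_hasFDerivAt x
      hs).mul ((u k).hasFDerivAt x)
  have hF' : ∀ x, fderiv ℝ (fun x => g (∑ j, u j x ^ 2) * u k x) x v =
      deriv g (∑ j, u j x ^ 2) * (2 * ∑ j, u j x * fderiv ℝ (u j) x v) * u k x +
          g (∑ j, u j x ^ 2) * fderiv ℝ (u k) x v := by
    intro x
    rw [(hF x).fderiv]
    simp only [add_apply, smul_apply, sum_apply, smul_eq_mul, Finset.mul_sum, Finset.sum_mul,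
      mul_assoc]
    rw [add_comm]
    congr 1
    exact Finset.sum_congr rfl fun j _ => by ring
  refine ⟨h1, h2, ?_⟩
  simp_rw [← hF'] at h2 ⊢
  have hdiff : Differentiable ℝ (fun y => fderiv ℝ (u k) y v) := by
    simp_rw [← hD]
    exact SchwartzMap.differentiable _
  rw [integral_mul_fderiv_eq_neg_fderiv_mul_of_integrable h1 h2 h3 (fun x _ => hdiff x)
    fun x _ => (hF x).differentiableAt, neg_neg]

end SchwartzMap

/-- Key taming estimate from the proof of Lemma 6.3: for `N > 0`, a Schwartz vector field
`u : ℝ³ → ℝ³`, and `g ∈ C¹(ℝ)` with `g′ ≥ 0` and `g(r) ≥ r − N` for `r ≥ 0`,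
`∫ ⟨Δu, g(|u|²)u⟩ dx ≤ −∫ |u|²|∇u|² dx + N ∫ |∇u|² dx`. -/
theorem stmt6 (N : ℝ) (hN : 0 < N)
    (u : Fin 3 → SchwartzMap (EuclideanSpace ℝ (Fin 3)) ℝ)
    (g : ℝ → ℝ) (hg : ContDiff ℝ 1 g)
    (hg' : ∀ r : ℝ, 0 ≤ deriv g r) (hgN : ∀ r : ℝ, 0 ≤ r → r - N ≤ g r) :
    (∫ x, ∑ k,
        (∑ i, fderiv ℝ (fun y => fderiv ℝ (fun z => u k z) y (EuclideanSpace.single i 1)) x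
            (EuclideanSpace.single i 1)) *
          (g (∑ j, (u j x) ^ 2) * u k x)) ≤
      -(∫ x, (∑ j, (u j x) ^ 2) *
          ∑ i, ∑ k, (fderiv ℝ (fun z => u k z) x (EuclideanSpace.single i 1)) ^ 2) +
      N * ∫ x, ∑ i, ∑ k, (fderiv ℝ (fun z => u k z) x (EuclideanSpace.single i 1)) ^ 2 := by
  let E := EuclideanSpace ℝ (Fin 3)
  let ρ : E → ℝ := fun x => ∑ j, u j x ^ 2
  let D : Fin 3 → Fin 3 → E → ℝ := fun i k x => fderiv ℝ (u k) x (EuclideanSpace.single i 1)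
  let P : Fin 3 → Fin 3 → E → ℝ := fun k i x => D i k x *
    (deriv g (ρ x) * (2 * ∑ j, u j x * D i j x) * u k x + g (ρ x) * D i k x)
  have key := fun k i : Fin 3 =>
    SchwartzMap.integral_fderiv_fderiv_mul_comp_sum_sq_mul (μ := volume) u hg k
      (EuclideanSpace.single i 1)
  have hP : ∀ k i, Integrable (P k i) := fun k i => (key k i).2.1
  have hL : (∫ x, ∑ k, (∑ i, fderiv ℝ (fun y => fderiv ℝ (fun z => u k z) y
      (EuclideanSpace.single i 1)) x (EuclideanSpace.single i 1)) * (g (ρ x) * u k x)) =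
      -∫ x, ∑ k, ∑ i, P k i x := by
    simp_rw [Finset.sum_mul]
    rw [integral_finsetSum _ fun k _ => integrable_finsetSum _ fun i _ => (key k i).1,
      integral_finsetSum _ fun k _ => integrable_finsetSum _ fun i _ => hP k i,
      ← Finset.sum_neg_distrib]
    refine Finset.sum_congr rfl fun k _ => ?_
    rw [integral_finsetSum _ fun i _ => (key k i).1, integral_finsetSum _ fun i _ => hP k i,
      ← Finset.sum_neg_distrib]
    exact Finset.sum_congr rfl fun i _ => (key k i).2.2
  have hgrad : ∀ φ : ℝ → ℝ, Continuous φ →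
      Integrable fun x => φ (ρ x) * ∑ i, ∑ k, D i k x ^ 2 := by
    intro φ hφ
    obtain ⟨H, hH⟩ := SchwartzMap.exists_boundedContinuousFunction_comp_sum_sq u hφ
    simp_rw [Finset.mul_sum]
    refine integrable_finsetSum _ fun i _ => integrable_finsetSum _ fun k _ => ?_
    let d : 𝓢(E, ℝ) := ∂_{(EuclideanSpace.single i 1 : E)} (u k)
    have hd : ∀ x, d x = D i k x := SchwartzMap.lineDerivOp_apply_eq_fderiv _ (u k)
    refine (d.integrable_mul_boundedContinuousFunction
      (H * d.toBoundedContinuousFunction)).congr (.of_forall fun x => ?_)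
    change d x * (H x * d x) = _
    rw [hH, hd]
    ring
  have h1 : Integrable fun x => ρ x * ∑ i, ∑ k, D i k x ^ 2 := hgrad id continuous_id
  have h2 : Integrable fun x => ∑ i, ∑ k, D i k x ^ 2 := by
    simpa using hgrad (fun _ => 1) continuous_const
  have hle : ∫ x, (ρ x * ∑ i, ∑ k, D i k x ^ 2 - N * ∑ i, ∑ k, D i k x ^ 2) ≤
      ∫ x, ∑ k, ∑ i, P k i x := by
    refine integral_mono (h1.sub (h2.const_mul N))
      (integrable_finsetSum _ fun k _ => integrable_finsetSum _ fun i _ => hP k i) fun x => ?_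
    have hsum : ∑ k, ∑ i, P k i x = 2 * deriv g (ρ x) * ∑ i, (∑ j, u j x * D i j x) ^ 2 +
        g (ρ x) * ∑ i, ∑ k, D i k x ^ 2 := by
      rw [Finset.sum_comm, Finset.mul_sum, Finset.mul_sum, ← Finset.sum_add_distrib]
      refine Finset.sum_congr rfl fun i _ => ?_
      simp only [P, mul_add, Finset.sum_add_distrib]
      congr 1
      · conv_rhs => rw [sq, ← mul_assoc, Finset.mul_sum]
        exact Finset.sum_congr rfl fun k _ => by ring
      · rw [Finset.mul_sum]
        exact Finset.sum_congr rfl fun k _ => by ring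
    have hS : 0 ≤ ∑ i, ∑ k, D i k x ^ 2 := by positivity
    have hT : 0 ≤ ∑ i, (∑ j, u j x * D i j x) ^ 2 := by positivity
    have hρ : 0 ≤ ρ x := Finset.sum_nonneg fun j _ => sq_nonneg _
    have := mul_nonneg (mul_nonneg zero_le_two (hg' (ρ x))) hT
    have := mul_le_mul_of_nonneg_right (hgN (ρ x) hρ) hS
    change _ ≤ ∑ k, ∑ i, P k i x
    rw [hsum]
    linarith
  rw [integral_sub h1 (h2.const_mul N), integral_const_mul] at hle
  refine hL.le.trans ?_
  change _ ≤ -(∫ x, ρ x * ∑ i, ∑ k, D i k x ^ 2) + N * ∫ x, ∑ i, ∑ k, D i k x ^ 2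
  linarith
end

section
/- Let N > 0, let u : ℝ³ → ℝ³ be a divergence-free Schwartz vector field, and let g : ℝ → ℝ be continuously differentiable with g(r) ≥ 0 and g(r) ≥ r − N for all r ≥ 0 and g′(r) ≥ 0 for all r. Then ∫_{ℝ³} ⟨u(x) − Δu(x), −(u·∇)u(x) − g(|u(x)|²) u(x)⟩ dx ≤ ¼ ∫_{ℝ³} |u(x) − Δu(x)|² dx + N ∫_{ℝ³} |∇u(x)|² dx. (This is the first-order energy estimate (6.12) of Lemma 6.3, ⟨u,F(u)⟩₁ ≤ ¼‖u‖₂² + N‖u‖₁², showing that the taming term controls the transport term in the stochastic tamed 3D Navier–Stokes equation; for divergence-free u the Leray projection P drops out of the pairing.) -/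
open MeasureTheory

open scoped SchwartzMap

/-- A continuous function of finitely many Schwartz functions, times a Schwartz function,
is integrable. -/
lemma integrable_continuous_comp_schwartz_mul {D ι : Type*} [NormedAddCommGroup D]
    [NormedSpace ℝ D] [MeasurableSpace D] [BorelSpace D] [SecondCountableTopology D]
    [Finite ι] {μ : Measure D} [μ.HasTemperateGrowth]
    (φ : ι → 𝓢(D, ℝ)) {Φ : (ι → ℝ) → ℝ} (hΦ : Continuous Φ) (ψ : 𝓢(D, ℝ)) :
    Integrable (fun x => Φ (fun j => φ j x) * ψ x) μ := by
  have hK : IsCompact (Set.univ.pi fun j =>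
      Set.Icc (-(SchwartzMap.seminorm ℝ 0 0 (φ j))) (SchwartzMap.seminorm ℝ 0 0 (φ j))) :=
    isCompact_univ_pi fun j => isCompact_Icc
  obtain ⟨C, hC⟩ := hK.exists_bound_of_continuousOn hΦ.continuousOn
  refine ψ.integrable.bdd_mul (c := C) ?_ ?_
  · exact (hΦ.comp (continuous_pi fun j => (φ j).continuous)).aestronglyMeasurable
  · refine Filter.Eventually.of_forall fun x => hC _ fun j _ => abs_le.mp ?_
    exact (φ j).norm_le_seminorm ℝ x

/-- The pointwise form of the energy estimate: `U`, `D`, `S` are the values of a vector field, its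
gradient and its Laplacian, `G` and `G'` those of the taming function and its derivative. -/
lemma tamed_pairing_le {ι : Type*} [Fintype ι] (N G G' : ℝ) (U S : ι → ℝ) (D : ι → ι → ℝ)
    (hG0 : 0 ≤ G) (hG : ∑ j, U j ^ 2 - N ≤ G) (hG' : 0 ≤ G') :
    ∑ k, (U k - S k) * (-(∑ i, U i * D i k) - G * U k) ≤
      1 / 4 * ∑ k, (U k - S k) ^ 2 + N * ∑ i, ∑ k, D i k ^ 2 +
        (∑ i, ∑ k, (G' * (2 * ∑ j, U j * D i j) * U k + G * D i k) * D i k +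
          ∑ k, G * U k * S k) := by
  have h1 : ∀ k, (U k - S k) * (-(∑ i, U i * D i k) - G * U k) ≤
      1 / 4 * (U k - S k) ^ 2 + (∑ j, U j ^ 2) * ∑ i, D i k ^ 2 + G * U k * S k := fun k => by
    have hCS := Finset.sum_mul_sq_le_sq_mul_sq Finset.univ U (fun i => D i k)
    nlinarith [sq_nonneg ((U k - S k) / 2 + ∑ i, U i * D i k), mul_nonneg hG0 (sq_nonneg (U k))]
  have h2 : ∀ i, ∑ k, (G' * (2 * ∑ j, U j * D i j) * U k + G * D i k) * D i k =
      2 * G' * (∑ j, U j * D i j) ^ 2 + G * ∑ k, D i k ^ 2 := fun i => by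
    have hs : ∀ s : ℝ, ∑ k, (G' * (2 * s) * U k + G * D i k) * D i k =
        2 * G' * (s * ∑ j, U j * D i j) + G * ∑ k, D i k ^ 2 := fun s => by
      simp only [Finset.mul_sum, ← Finset.sum_add_distrib]
      exact Finset.sum_congr rfl fun k _ => by ring
    rw [hs, sq]
  have h3 := Finset.sum_le_sum fun k (_ : k ∈ Finset.univ) => h1 k
  simp only [Finset.sum_add_distrib, ← Finset.mul_sum] at h3
  rw [Finset.sum_comm] at h3
  simp only [h2, Finset.sum_add_distrib, ← Finset.mul_sum]
  have h4 : 0 ≤ G' * ∑ i, (∑ j, U j * D i j) ^ 2 := by positivity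
  have h5 : 0 ≤ ∑ i, ∑ k, D i k ^ 2 := by positivity
  simp only [mul_assoc, ← Finset.mul_sum] at h3 ⊢
  nlinarith [mul_nonneg (sub_nonneg.2 hG) h5]

/-- Integration by parts for `g(|u|²) u_k` against a Schwartz function `w`. -/
lemma integral_taming_parts {D ι : Type*} [NormedAddCommGroup D] [NormedSpace ℝ D]
    [FiniteDimensional ℝ D] [MeasurableSpace D] [BorelSpace D] [Fintype ι]
    (μ : Measure D) [μ.IsAddHaarMeasure]
    (u : ι → 𝓢(D, ℝ)) {g : ℝ → ℝ} (hg : ContDiff ℝ 1 g) (k : ι) (w : 𝓢(D, ℝ)) (v : D) :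
    Integrable (fun x => (deriv g (∑ j, u j x ^ 2) * (2 * ∑ j, u j x * fderiv ℝ (u j) x v) * u k x +
        g (∑ j, u j x ^ 2) * fderiv ℝ (u k) x v) * w x) μ ∧
      Integrable (fun x => g (∑ j, u j x ^ 2) * u k x * fderiv ℝ w x v) μ ∧
      (∫ x, (deriv g (∑ j, u j x ^ 2) * (2 * ∑ j, u j x * fderiv ℝ (u j) x v) * u k x +
        g (∑ j, u j x ^ 2) * fderiv ℝ (u k) x v) * w x ∂μ) +
        ∫ x, g (∑ j, u j x ^ 2) * u k x * fderiv ℝ w x v ∂μ = 0 := by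
  have hgc : Continuous g := hg.continuous
  have hgc' : Continuous (deriv g) := hg.continuous_deriv le_rfl
  have hd : ∀ x, HasFDerivAt (fun x => g (∑ j, u j x ^ 2) * u k x)
      (g (∑ j, u j x ^ 2) • fderiv ℝ (u k) x + u k x • (deriv g (∑ j, u j x ^ 2) •
        ∑ j, (2 * u j x ^ 1) • fderiv ℝ (u j) x)) x := fun x => by
    have hu : ∀ j, HasFDerivAt (u j) (fderiv ℝ (u j) x) x := fun j =>
      (u j).differentiableAt.hasFDerivAt
    have hs : HasFDerivAt (fun x => ∑ j, u j x ^ 2)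
        (∑ j, (2 * u j x ^ 1) • fderiv ℝ (u j) x) x :=
      HasFDerivAt.fun_sum fun j _ => by simpa using (hu j).pow 2
    exact (((hg.differentiable one_ne_zero _).hasDerivAt.comp_hasFDerivAt x hs).mul (hu k))
  have hd' : ∀ x, fderiv ℝ (fun x => g (∑ j, u j x ^ 2) * u k x) x v =
      deriv g (∑ j, u j x ^ 2) * (2 * ∑ j, u j x * fderiv ℝ (u j) x v) * u k x +
        g (∑ j, u j x ^ 2) * fderiv ℝ (u k) x v := fun x => by
    rw [(hd x).fderiv]
    simp [mul_assoc, ← Finset.mul_sum]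
    ring
  have i1 : Integrable (fun x => (deriv g (∑ j, u j x ^ 2) *
      (2 * ∑ j, u j x * fderiv ℝ (u j) x v) * u k x +
        g (∑ j, u j x ^ 2) * fderiv ℝ (u k) x v) * w x) μ :=
    integrable_continuous_comp_schwartz_mul
      (Sum.elim u fun j => LineDeriv.lineDerivOp v (u j))
      (Φ := fun y => deriv g (∑ j, y (.inl j) ^ 2) * (2 * ∑ j, y (.inl j) * y (.inr j)) *
        y (.inl k) + g (∑ j, y (.inl j) ^ 2) * y (.inr k)) (by fun_prop) w
  have i2 : ∀ w : 𝓢(D, ℝ), Integrable (fun x => g (∑ j, u j x ^ 2) * u k x * w x) μ := fun w =>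
    integrable_continuous_comp_schwartz_mul u
      (Φ := fun y => g (∑ j, y j ^ 2) * y k) (by fun_prop) w
  have i3 : Integrable (fun x => g (∑ j, u j x ^ 2) * u k x * fderiv ℝ w x v) μ :=
    i2 (LineDeriv.lineDerivOp v w)
  refine ⟨i1, i3, ?_⟩
  have key := integral_mul_fderiv_eq_neg_fderiv_mul_of_integrable (μ := μ)
    (f := fun x => g (∑ j, u j x ^ 2) * u k x) (g := w) (v := v)
    (by simpa only [hd'] using i1) i3 (i2 w)
    (fun x _ => (hd x).differentiableAt) (fun x _ => w.differentiableAt)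
  simp only [hd'] at key
  linarith

/-- The square of a Schwartz function is integrable. -/
lemma integrable_schwartz_sq {D : Type*} [NormedAddCommGroup D]
    [NormedSpace ℝ D] [MeasurableSpace D] [BorelSpace D] [SecondCountableTopology D]
    {μ : Measure D} [μ.HasTemperateGrowth] (ψ : 𝓢(D, ℝ)) :
    Integrable (fun x => ψ x ^ 2) μ := by
  simpa only [sq] using integrable_continuous_comp_schwartz_mul (fun _ : Unit => ψ)
    (Φ := fun y => y ()) (by fun_prop) ψ

/-- First-order energy estimate (6.12) of Lemma 6.3: for `N > 0`, a divergence-free Schwartz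
vector field `u : ℝ³ → ℝ³`, and `g ∈ C¹(ℝ)` with `g ≥ 0` and `g(r) ≥ r − N` on `r ≥ 0`
and `g′ ≥ 0`, one has
`∫ ⟨u − Δu, −(u·∇)u − g(|u|²)u⟩ dx ≤ ¼ ∫ |u − Δu|² dx + N ∫ |∇u|² dx`. -/
theorem stmt7 (N : ℝ) (hN : 0 < N)
    (u : Fin 3 → SchwartzMap (EuclideanSpace ℝ (Fin 3)) ℝ)
    (hdiv : ∀ x, ∑ i, fderiv ℝ (fun y => u i y) x (EuclideanSpace.single i 1) = 0)
    (g : ℝ → ℝ) (hg : ContDiff ℝ 1 g)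
    (hg0 : ∀ r : ℝ, 0 ≤ r → 0 ≤ g r) (hgN : ∀ r : ℝ, 0 ≤ r → r - N ≤ g r)
    (hg' : ∀ r : ℝ, 0 ≤ deriv g r) :
    (∫ x, ∑ k,
        (u k x - ∑ i, fderiv ℝ (fun y => fderiv ℝ (fun z => u k z) y (EuclideanSpace.single i 1))
            x (EuclideanSpace.single i 1)) *
          (-(∑ i, u i x * fderiv ℝ (fun y => u k y) x (EuclideanSpace.single i 1)) -
            g (∑ j, (u j x) ^ 2) * u k x)) ≤
      (1 / 4) * (∫ x, ∑ k,
          (u k x - ∑ i, fderiv ℝ (fun y => fderiv ℝ (fun z => u k z) y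
              (EuclideanSpace.single i 1)) x (EuclideanSpace.single i 1)) ^ 2) +
      N * ∫ x, ∑ i, ∑ k, (fderiv ℝ (fun z => u k z) x (EuclideanSpace.single i 1)) ^ 2 := by
  let e : Fin 3 → EuclideanSpace ℝ (Fin 3) := fun i => EuclideanSpace.single i 1
  let D : Fin 3 → Fin 3 → 𝓢(EuclideanSpace ℝ (Fin 3), ℝ) := fun i k =>
    LineDeriv.lineDerivOp (e i) (u k)
  let DD : Fin 3 → Fin 3 → 𝓢(EuclideanSpace ℝ (Fin 3), ℝ) := fun i k =>
    LineDeriv.lineDerivOp (e i) (D i k)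
  change (∫ x, ∑ k, (u k x - ∑ i, DD i k x) * (-(∑ i, u i x * D i k x) -
      g (∑ j, (u j x) ^ 2) * u k x)) ≤
    (1 / 4) * (∫ x, ∑ k, (u k x - ∑ i, DD i k x) ^ 2) + N * ∫ x, ∑ i, ∑ k, D i k x ^ 2
  let P : Fin 3 → Fin 3 → EuclideanSpace ℝ (Fin 3) → ℝ := fun i k x =>
    (deriv g (∑ j, u j x ^ 2) * (2 * ∑ j, u j x * D i j x) * u k x +
      g (∑ j, u j x ^ 2) * D i k x) * D i k x
  let Q : Fin 3 → Fin 3 → EuclideanSpace ℝ (Fin 3) → ℝ := fun i k x =>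
    g (∑ j, u j x ^ 2) * u k x * DD i k x
  have parts : ∀ i k, Integrable (P i k) ∧ Integrable (Q i k) ∧
      (∫ x, P i k x) + ∫ x, Q i k x = 0 := fun i k =>
    integral_taming_parts volume u hg k (D i k) (e i)
  have hPQ1 : ∀ i k, Integrable (fun x => P i k x + Q i k x) := fun i k =>
    (parts i k).1.add (parts i k).2.1
  have hPQ2 : ∀ i, Integrable (fun x => ∑ k, (P i k x + Q i k x)) := fun i =>
    integrable_finsetSum _ fun k _ => hPQ1 i k
  have hPQ : Integrable (fun x => ∑ i, ∑ k, (P i k x + Q i k x)) :=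
    integrable_finsetSum _ fun i _ => hPQ2 i
  have hPQ0 : ∫ x, ∑ i, ∑ k, (P i k x + Q i k x) = 0 := by
    rw [integral_finsetSum _ fun i _ => hPQ2 i]
    refine Finset.sum_eq_zero fun i _ => ?_
    rw [integral_finsetSum _ fun k _ => hPQ1 i k]
    refine Finset.sum_eq_zero fun k _ => ?_
    rw [integral_add (parts i k).1 (parts i k).2.1, (parts i k).2.2]
  have hL : Integrable (fun x => ∑ k, (u k x - ∑ i, DD i k x) ^ 2) :=
    integrable_finsetSum _ fun k _ => by
      simpa using integrable_schwartz_sq (μ := volume) (u k - ∑ i, DD i k)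
  have hD : Integrable (fun x => ∑ i, ∑ k, D i k x ^ 2) :=
    integrable_finsetSum _ fun i _ => integrable_finsetSum _ fun k _ =>
      integrable_schwartz_sq (D i k)
  have hLD : Integrable (fun x => 1 / 4 * ∑ k, (u k x - ∑ i, DD i k x) ^ 2 +
      N * ∑ i, ∑ k, D i k x ^ 2) := (hL.const_mul _).add (hD.const_mul _)
  by_cases hint : Integrable (fun x => ∑ k, (u k x - ∑ i, DD i k x) *
      (-(∑ i, u i x * D i k x) - g (∑ j, (u j x) ^ 2) * u k x))
  · calc
      _ ≤ ∫ x, (1 / 4 * ∑ k, (u k x - ∑ i, DD i k x) ^ 2 + N * ∑ i, ∑ k, D i k x ^ 2 +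
          ∑ i, ∑ k, (P i k x + Q i k x)) := by
        refine integral_mono hint (hLD.add hPQ) fun x => ?_
        have hr : 0 ≤ ∑ j, u j x ^ 2 := by positivity
        have hp := tamed_pairing_le N (g (∑ j, u j x ^ 2)) (deriv g (∑ j, u j x ^ 2))
          (fun k => u k x) (fun k => ∑ i, DD i k x) (fun i k => D i k x)
          (hg0 _ hr) (hgN _ hr) (hg' _)
        have hQ : ∑ i, ∑ k, Q i k x =
            ∑ k, g (∑ j, u j x ^ 2) * u k x * ∑ i, DD i k x := by
          simp only [Finset.mul_sum, Q]
          exact Finset.sum_comm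
        simp only [Finset.sum_add_distrib (f := fun k => P _ k x), hQ,
          Finset.sum_add_distrib (f := fun i => ∑ k, P i k x)]
        exact hp
      _ = _ := by
        rw [integral_add hLD hPQ, hPQ0,
          integral_add (hL.const_mul _) (hD.const_mul _), integral_const_mul,
          integral_const_mul, add_zero]
  · rw [integral_undef hint]
    positivity
end

section
/- There exists a universal constant C > 0 such that for every Schwartz vector field u : ℝ² → ℝ², ∫_{ℝ²} ∑_{i,k=1}^2 ( ∂_{x_i}[ ((u·∇)u)_k ](x) )² dx ≤ ¼ ‖u‖₃² + C ‖u‖₂² ‖u‖₁² ( 1 + ‖u‖₀² ). (This is the estimate ‖∇((u·∇)u)‖₀² ≤ ¼‖u‖₃² + C‖u‖₂²‖u‖₁²(1+‖u‖₀²) established in the proof of Lemma 7.1 for the 2D Navier–Stokes nonlinearity, using the two-dimensional Ladyzhenskaya inequalities ‖v‖_{L⁴}⁴ ≤ C‖v‖₁²‖v‖₀² and ‖v‖_{L^∞}⁴ ≤ C‖v‖₂²‖v‖₀².) -/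
open MeasureTheory

/-- Squared Sobolev `H^s`-norm of a Schwartz vector field `u : ℝ^d → ℝ^d` (given by its
components), `‖u‖_s² = ∑_{j=0}^s ∫ ‖D^j u(x)‖² dx` with `‖·‖` the Frobenius norm of the
`j`-th total derivative, computed in coordinates on the standard orthonormal basis. -/
noncomputable def sobNormSq (d s : ℕ)
    (u : Fin d → SchwartzMap (EuclideanSpace ℝ (Fin d)) ℝ) : ℝ :=
  ∑ j ∈ Finset.range (s + 1), ∫ x, ∑ k, ∑ i : Fin j → Fin d,
    (iteratedFDeriv ℝ j (fun y => u k y) x (fun l => EuclideanSpace.single (i l) 1)) ^ 2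

section

open SchwartzMap LineDeriv

/-- The `i`-th partial derivative of a real Schwartz function on the plane. -/
noncomputable abbrev SchwartzMap.partialDeriv (i : Fin 2)
    (f : SchwartzMap (EuclideanSpace ℝ (Fin 2)) ℝ) : SchwartzMap (EuclideanSpace ℝ (Fin 2)) ℝ :=
  ∂_{EuclideanSpace.single i (1 : ℝ)} f

/-- One-dimensional fundamental theorem of calculus bound for a function vanishing at `-∞`. -/
theorem enorm_le_lintegral_of_hasDerivAt_of_tendsto {g g' : ℝ → ℝ}
    (hg : ∀ s, HasDerivAt g (g' s) s) (hg' : Continuous g')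
    (h0 : Filter.Tendsto g Filter.atBot (nhds 0)) (x : ℝ) :
    ‖g x‖ₑ ≤ ∫⁻ s, ‖g' s‖ₑ := by
  by_cases hfin : ∫⁻ s, ‖g' s‖ₑ = ⊤
  · simp [hfin]
  have hint : Integrable g' := ⟨hg'.aestronglyMeasurable, lt_top_iff_ne_top.2 hfin⟩
  have h := integral_Iic_of_hasDerivAt_of_tendsto' (a := x) (fun s _ => hg s)
    hint.integrableOn h0
  rw [sub_zero] at h
  rw [← h]
  exact (enorm_integral_le_lintegral_enorm _).trans (setLIntegral_le_lintegral _ _)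

/-- The `L²` norm of a planar Schwartz function is bounded by the `L¹` norm of its gradient. -/
theorem SchwartzMap.integral_sq_le_sq_integral_abs_lineDeriv
    (w : SchwartzMap (EuclideanSpace ℝ (Fin 2)) ℝ) :
    ∫ x, w x ^ 2 ≤ (∫ x, ∑ i, |w.partialDeriv i x|) ^ 2 := by
  set G : EuclideanSpace ℝ (Fin 2) → ℝ :=
    fun x => ∑ i, |w.partialDeriv i x|
  have hGc : Continuous G :=
    continuous_finsetSum _ fun i _ =>
      (w.partialDeriv i).continuous.abs
  have hG0 : ∀ x, 0 ≤ G x := fun x => Finset.sum_nonneg fun _ _ => abs_nonneg _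
  have hGi : Integrable G := integrable_finsetSum _ fun i _ =>
    (w.partialDeriv i).integrable.abs
  have hmp := PiLp.volume_preserving_toLp (Fin 2)
  have hline : ∀ (x : Fin 2 → ℝ) (i : Fin 2),
      ‖w (WithLp.toLp 2 x)‖ₑ ≤
        ∫⁻ s, ‖G (WithLp.toLp 2 (Function.update x i s))‖ₑ := by
    intro x i
    have hup : ∀ s, HasDerivAt (fun s => WithLp.toLp 2 (Function.update x i s))
        (EuclideanSpace.single i (1 : ℝ)) s := fun s =>
      (PiLp.continuousLinearEquiv 2 ℝ (fun _ : Fin 2 => ℝ)).symm.hasFDerivAt.comp_hasDerivAt s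
        (hasDerivAt_update x i s)
    have hcont : Continuous (fun s => WithLp.toLp 2 (Function.update x i s)) :=
      continuous_iff_continuousAt.2 fun s => (hup s).continuousAt
    have hd : ∀ s, HasDerivAt (fun s => w (WithLp.toLp 2 (Function.update x i s)))
        (w.partialDeriv i (WithLp.toLp 2 (Function.update x i s))) s := by
      intro s
      rw [lineDerivOp_apply_eq_fderiv]
      exact (w.differentiableAt (x := _)).hasFDerivAt.comp_hasDerivAt s (hup s)
    have hemb : Topology.IsClosedEmbedding
        (fun s => WithLp.toLp 2 (Function.update x i s)) :=
      (PiLp.homeomorph 2 (fun _ : Fin 2 => ℝ)).symm.isClosedEmbedding.comp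
        (isClosedEmbedding_update x i)
    have h0 : Filter.Tendsto (fun s => w (WithLp.toLp 2 (Function.update x i s)))
        Filter.atBot (nhds 0) :=
      (w.toZeroAtInfty.zero_at_infty'.comp hemb.tendsto_cocompact).mono_left atBot_le_cocompact
    have h := enorm_le_lintegral_of_hasDerivAt_of_tendsto hd
      ((w.partialDeriv i).continuous.comp hcont) h0 (x i)
    rw [Function.update_eq_self] at h
    refine h.trans (lintegral_mono fun s => ?_)
    rw [enorm_le_iff_norm_le, Real.norm_eq_abs, Real.norm_of_nonneg (hG0 _)]
    exact Finset.single_le_sum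
      (f := fun j => |w.partialDeriv j (WithLp.toLp 2 (Function.update x i s))|)
      (fun _ _ => abs_nonneg _) (Finset.mem_univ i)
  have hgrid : ∫⁻ x : Fin 2 → ℝ, ‖w (WithLp.toLp 2 x)‖ₑ ^ 2 ≤
      (∫⁻ x : Fin 2 → ℝ, ‖G (WithLp.toLp 2 x)‖ₑ) ^ 2 := by
    have hp : Real.HolderConjugate (Fintype.card (Fin 2)) 2 := by
      simpa using Real.HolderConjugate.two_two
    have h := lintegral_prod_lintegral_pow_le (fun _ : Fin 2 => (volume : Measure ℝ)) hp
      (f := fun x => ‖G (WithLp.toLp 2 x)‖ₑ)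
      (hGc.comp (PiLp.continuous_toLp 2 _)).enorm.measurable
    rw [← volume_pi, ENNReal.rpow_two] at h
    refine le_trans (lintegral_mono fun x => ?_) h
    norm_num
    rw [sq]
    exact mul_le_mul' (hline x 0) (hline x 1)
  have hE : ∫⁻ x, ‖w x‖ₑ ^ 2 ≤ (∫⁻ x, ‖G x‖ₑ) ^ 2 := by
    rwa [← hmp.lintegral_comp (w.continuous.enorm.measurable.pow_const 2),
      ← hmp.lintegral_comp hGc.enorm.measurable]
  have hL : ∫ x, w x ^ 2 = (∫⁻ x, ‖w x‖ₑ ^ 2).toReal := by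
    rw [integral_eq_lintegral_of_nonneg_ae (Filter.Eventually.of_forall fun x => sq_nonneg _)
      (w.continuous.pow 2).aestronglyMeasurable]
    congr 2 with x
    rw [← enorm_pow, Real.enorm_of_nonneg (sq_nonneg _)]
  have hR : ∫ x, G x = (∫⁻ x, ‖G x‖ₑ).toReal := by
    rw [← integral_norm_eq_lintegral_enorm hGc.aestronglyMeasurable]
    exact integral_congr_ae (Filter.Eventually.of_forall fun x => (Real.norm_of_nonneg (hG0 x)).symm)
  rw [hL, hR, ← ENNReal.toReal_pow]
  exact ENNReal.toReal_mono (ENNReal.pow_ne_top hGi.hasFiniteIntegral.ne) hE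

/-- Cauchy–Schwarz inequality for real square integrable functions. -/
theorem sq_integral_mul_le_of_memLp_two {α : Type*} [MeasurableSpace α] {μ : Measure α}
    {f g : α → ℝ} (hf : MemLp f 2 μ) (hg : MemLp g 2 μ) :
    (∫ x, f x * g x ∂μ) ^ 2 ≤ (∫ x, f x ^ 2 ∂μ) * ∫ x, g x ^ 2 ∂μ := by
  have hff := hf.integrable_sq
  have hgg := hg.integrable_sq
  have hfg : Integrable (fun x => f x * g x) μ := hf.integrable_mul hg
  have h := discrim_le_zero (a := ∫ x, f x ^ 2 ∂μ) (b := 2 * ∫ x, f x * g x ∂μ)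
    (c := ∫ x, g x ^ 2 ∂μ) fun t => by
      have h0 : 0 ≤ ∫ x, (t * f x + g x) ^ 2 ∂μ := integral_nonneg fun x => sq_nonneg _
      have h1 : ∫ x, (t * f x + g x) ^ 2 ∂μ =
          ∫ x, (t * t * f x ^ 2 + 2 * t * (f x * g x) + g x ^ 2) ∂μ := by
        congr 1 with x
        ring
      have h2 : Integrable (fun x => t * t * f x ^ 2 + 2 * t * (f x * g x)) μ :=
        (hff.const_mul _).add (hfg.const_mul _)
      rw [h1, integral_add h2 hgg, integral_add (hff.const_mul _) (hfg.const_mul _),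
        integral_const_mul, integral_const_mul] at h0
      linarith
  rw [discrim] at h
  linarith

/-- The pointwise product of two real Schwartz functions on the plane. -/
noncomputable abbrev SchwartzMap.prod (f g : SchwartzMap (EuclideanSpace ℝ (Fin 2)) ℝ) :
    SchwartzMap (EuclideanSpace ℝ (Fin 2)) ℝ :=
  pairing (ContinuousLinearMap.mul ℝ ℝ) f g

theorem SchwartzMap.partialDeriv_prod (i : Fin 2)
    (f g : SchwartzMap (EuclideanSpace ℝ (Fin 2)) ℝ) (x : EuclideanSpace ℝ (Fin 2)) :
    (f.prod g).partialDeriv i x = f.partialDeriv i x * g x + f x * g.partialDeriv i x := by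
  simp only [lineDerivOp_apply_eq_fderiv]
  have h : (f.prod g : EuclideanSpace ℝ (Fin 2) → ℝ) = fun y => f y * g y := rfl
  rw [h, fderiv_fun_mul f.differentiableAt g.differentiableAt]
  simp
  ring

/-- The planar Ladyzhenskaya inequality for Schwartz functions. -/
theorem SchwartzMap.integral_pow_four_le
    (f : SchwartzMap (EuclideanSpace ℝ (Fin 2)) ℝ) :
    ∫ x, f x ^ 4 ≤ 8 * (∫ x, f x ^ 2) * ∑ i, ∫ x, f.partialDeriv i x ^ 2 := by
  have h := (f.prod f).integral_sq_le_sq_integral_abs_lineDeriv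
  have h1 : ∫ x, (f.prod f) x ^ 2 = ∫ x, f x ^ 4 := by
    congr 1 with x
    simp
    ring
  have h2 : ∫ x, ∑ i, |(f.prod f).partialDeriv i x| =
      ∫ x, (2 * |f x|) * ∑ i, |f.partialDeriv i x| := by
    congr 1 with x
    rw [Finset.mul_sum]
    refine Finset.sum_congr rfl fun i _ => ?_
    rw [partialDeriv_prod, mul_comm, ← two_mul, abs_mul, abs_mul, abs_two, mul_assoc]
  have hm : ∀ i, MemLp (fun x => |f.partialDeriv i x|) 2 volume := fun i =>
    ((f.partialDeriv i).memLp 2).norm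
  have h3 := sq_integral_mul_le_of_memLp_two ((f.memLp 2).norm.const_mul 2)
    (memLp_finsetSum Finset.univ fun i _ => hm i)
  have h4 : ∫ x, (2 * ‖f x‖) ^ 2 = 4 * ∫ x, f x ^ 2 := by
    rw [← integral_const_mul]
    congr 1 with x
    rw [mul_pow, Real.norm_eq_abs, sq_abs]
    norm_num
  have h5 : ∫ x, (∑ i, |f.partialDeriv i x|) ^ 2 ≤ 2 * ∑ i, ∫ x, f.partialDeriv i x ^ 2 := by
    rw [← integral_finsetSum _ fun i _ => ((f.partialDeriv i).memLp 2).integrable_sq,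
      ← integral_const_mul]
    refine integral_mono (memLp_finsetSum Finset.univ fun i _ => hm i).integrable_sq
      ((integrable_finsetSum _ fun i _ =>
        ((f.partialDeriv i).memLp 2).integrable_sq).const_mul 2) fun x => ?_
    simpa using sq_sum_le_card_mul_sum_sq (s := Finset.univ)
      (f := fun i => |f.partialDeriv i x|)
  have h6 : 0 ≤ ∫ x, f x ^ 2 := integral_nonneg fun x => sq_nonneg _
  rw [h1, h2] at h
  rw [h4] at h3
  calc ∫ x, f x ^ 4 ≤ _ := h
    _ ≤ _ := h3
    _ ≤ (4 * ∫ x, f x ^ 2) * (2 * ∑ i, ∫ x, f.partialDeriv i x ^ 2) := by gcongr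
    _ = _ := by ring

/-- Bound on the `L²` norm of a product of planar Schwartz functions. -/
theorem SchwartzMap.sq_integral_sq_mul_sq_le
    (f g : SchwartzMap (EuclideanSpace ℝ (Fin 2)) ℝ) :
    (∫ x, (f x * g x) ^ 2) ^ 2 ≤
      (8 * (∫ x, f x ^ 2) * ∑ i, ∫ x, f.partialDeriv i x ^ 2) *
        (8 * (∫ x, g x ^ 2) * ∑ i, ∫ x, g.partialDeriv i x ^ 2) := by
  have h := sq_integral_mul_le_of_memLp_two ((f.prod f).memLp 2) ((g.prod g).memLp 2)
  have h1 : ∫ x, (f.prod f) x * (g.prod g) x = ∫ x, (f x * g x) ^ 2 := by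
    congr 1 with x
    simp
    ring
  have h2 : ∀ f : SchwartzMap (EuclideanSpace ℝ (Fin 2)) ℝ,
      ∫ x, (f.prod f) x ^ 2 = ∫ x, f x ^ 4 := fun f => by
    congr 1 with x
    simp
    ring
  rw [h1, h2, h2] at h
  exact h.trans (mul_le_mul f.integral_pow_four_le g.integral_pow_four_le
    (integral_nonneg fun x => by positivity)
    ((integral_nonneg fun x => by positivity).trans f.integral_pow_four_le))

/-- The squared `L²` norm of the full `j`-th derivative of a planar Schwartz vector field. -/
noncomputable def derivNormSq (j : ℕ)
    (u : Fin 2 → SchwartzMap (EuclideanSpace ℝ (Fin 2)) ℝ) : ℝ :=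
  ∫ x, ∑ k, ∑ i : Fin j → Fin 2,
    (iteratedFDeriv ℝ j (fun y => u k y) x (fun l => EuclideanSpace.single (i l) 1)) ^ 2

theorem derivNormSq_eq_sum (j : ℕ) (u : Fin 2 → SchwartzMap (EuclideanSpace ℝ (Fin 2)) ℝ) :
    derivNormSq j u = ∑ k, ∑ i : Fin j → Fin 2,
      ∫ x, (∂^{fun l => EuclideanSpace.single (i l) (1 : ℝ)} (u k) :
        SchwartzMap (EuclideanSpace ℝ (Fin 2)) ℝ) x ^ 2 := by
  have hi : ∀ (k : Fin 2) (i : Fin j → Fin 2), Integrable fun x =>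
      (∂^{fun l => EuclideanSpace.single (i l) (1 : ℝ)} (u k) :
        SchwartzMap (EuclideanSpace ℝ (Fin 2)) ℝ) x ^ 2 :=
    fun k i => (SchwartzMap.memLp (∂^{_} (u k)) 2 volume).integrable_sq
  simp_rw [← integral_finsetSum _ fun i _ => hi _ i]
  rw [← integral_finsetSum _ fun k _ => integrable_finsetSum _ fun i _ => hi k i]
  simp_rw [iteratedLineDerivOp_eq_iteratedFDeriv]
  rfl

theorem derivNormSq_nonneg (j : ℕ) (u : Fin 2 → SchwartzMap (EuclideanSpace ℝ (Fin 2)) ℝ) :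
    0 ≤ derivNormSq j u :=
  integral_nonneg fun _ => by positivity

theorem integral_iteratedLineDerivOp_sq_le_derivNormSq {j : ℕ}
    (u : Fin 2 → SchwartzMap (EuclideanSpace ℝ (Fin 2)) ℝ) (k : Fin 2) (i : Fin j → Fin 2) :
    ∫ x, (∂^{fun l => EuclideanSpace.single (i l) (1 : ℝ)} (u k) :
      SchwartzMap (EuclideanSpace ℝ (Fin 2)) ℝ) x ^ 2 ≤ derivNormSq j u := by
  rw [derivNormSq_eq_sum]
  have h0 : ∀ (k : Fin 2) (i : Fin j → Fin 2),
      0 ≤ ∫ x, (∂^{fun l => EuclideanSpace.single (i l) (1 : ℝ)} (u k) :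
        SchwartzMap (EuclideanSpace ℝ (Fin 2)) ℝ) x ^ 2 :=
    fun k i => integral_nonneg fun _ => sq_nonneg _
  refine le_trans ?_ (Finset.single_le_sum (fun k _ => Finset.sum_nonneg fun i _ => h0 k i)
    (Finset.mem_univ k))
  exact Finset.single_le_sum (fun i _ => h0 k i) (Finset.mem_univ i)

theorem sobNormSq_two_eq_sum (s : ℕ) (u : Fin 2 → SchwartzMap (EuclideanSpace ℝ (Fin 2)) ℝ) :
    sobNormSq 2 s u = ∑ j ∈ Finset.range (s + 1), derivNormSq j u := rfl

theorem derivNormSq_le_sobNormSq (s : ℕ)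
    (u : Fin 2 → SchwartzMap (EuclideanSpace ℝ (Fin 2)) ℝ) :
    derivNormSq s u ≤ sobNormSq 2 s u := by
  rw [sobNormSq_two_eq_sum]
  exact Finset.single_le_sum (fun j _ => derivNormSq_nonneg j u)
    (Finset.mem_range.2 s.lt_succ_self)

theorem integral_sq_le_derivNormSq
    (u : Fin 2 → SchwartzMap (EuclideanSpace ℝ (Fin 2)) ℝ) (k : Fin 2) :
    ∫ x, u k x ^ 2 ≤ derivNormSq 0 u :=
  integral_iteratedLineDerivOp_sq_le_derivNormSq u k ![]

theorem integral_partialDeriv_sq_le_derivNormSq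
    (u : Fin 2 → SchwartzMap (EuclideanSpace ℝ (Fin 2)) ℝ) (k i : Fin 2) :
    ∫ x, (u k).partialDeriv i x ^ 2 ≤ derivNormSq 1 u :=
  integral_iteratedLineDerivOp_sq_le_derivNormSq u k ![i]

theorem integral_partialDeriv_partialDeriv_sq_le_derivNormSq
    (u : Fin 2 → SchwartzMap (EuclideanSpace ℝ (Fin 2)) ℝ) (k i j : Fin 2) :
    ∫ x, ((u k).partialDeriv j).partialDeriv i x ^ 2 ≤ derivNormSq 2 u :=
  integral_iteratedLineDerivOp_sq_le_derivNormSq u k ![i, j]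

theorem integral_partialDeriv_partialDeriv_partialDeriv_sq_le_derivNormSq
    (u : Fin 2 → SchwartzMap (EuclideanSpace ℝ (Fin 2)) ℝ) (k i j l : Fin 2) :
    ∫ x, (((u k).partialDeriv l).partialDeriv j).partialDeriv i x ^ 2 ≤ derivNormSq 3 u :=
  integral_iteratedLineDerivOp_sq_le_derivNormSq u k ![i, j, l]

theorem SchwartzMap.sq_integral_sq_mul_sq_le_of_le
    (f g : SchwartzMap (EuclideanSpace ℝ (Fin 2)) ℝ) {a b c d : ℝ}
    (ha : ∫ x, f x ^ 2 ≤ a) (hb : ∀ i, ∫ x, f.partialDeriv i x ^ 2 ≤ b)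
    (hc : ∫ x, g x ^ 2 ≤ c) (hd : ∀ i, ∫ x, g.partialDeriv i x ^ 2 ≤ d) :
    (∫ x, (f x * g x) ^ 2) ^ 2 ≤ 16 ^ 2 * ((a * b) * (c * d)) := by
  have h0 : ∀ f : SchwartzMap (EuclideanSpace ℝ (Fin 2)) ℝ, 0 ≤ ∫ x, f x ^ 2 :=
    fun f => integral_nonneg fun _ => sq_nonneg _
  have hb' : ∑ i, ∫ x, f.partialDeriv i x ^ 2 ≤ 2 * b := by
    simpa using Finset.sum_le_card_nsmul Finset.univ _ b fun i _ => hb i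
  have hd' : ∑ i, ∫ x, g.partialDeriv i x ^ 2 ≤ 2 * d := by
    simpa using Finset.sum_le_card_nsmul Finset.univ _ d fun i _ => hd i
  have hf0 : 0 ≤ ∑ i, ∫ x, f.partialDeriv i x ^ 2 := Finset.sum_nonneg fun i _ => h0 _
  have hg0 : 0 ≤ ∑ i, ∫ x, g.partialDeriv i x ^ 2 := Finset.sum_nonneg fun i _ => h0 _
  have ha0 : 0 ≤ a := (h0 _).trans ha
  have hb0 : 0 ≤ b := (h0 _).trans (hb 0)
  have hc0 : 0 ≤ c := (h0 _).trans hc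
  have hf := h0 f
  have hg := h0 g
  calc _ ≤ _ := f.sq_integral_sq_mul_sq_le g
    _ ≤ (8 * a * (2 * b)) * (8 * c * (2 * d)) := by gcongr
    _ = _ := by ring

theorem integral_mul_partialDeriv_sq_le
    (u : Fin 2 → SchwartzMap (EuclideanSpace ℝ (Fin 2)) ℝ) (i j k : Fin 2) :
    ∫ x, ((u j).partialDeriv i x * (u k).partialDeriv j x) ^ 2 ≤
      16 * (derivNormSq 1 u * derivNormSq 2 u) := by
  have h := ((u j).partialDeriv i).sq_integral_sq_mul_sq_le_of_le ((u k).partialDeriv j)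
    (integral_partialDeriv_sq_le_derivNormSq u j i)
    (fun l => integral_partialDeriv_partialDeriv_sq_le_derivNormSq u j l i)
    (integral_partialDeriv_sq_le_derivNormSq u k j)
    (fun l => integral_partialDeriv_partialDeriv_sq_le_derivNormSq u k l j)
  have h1 := derivNormSq_nonneg 1 u
  have h2 := derivNormSq_nonneg 2 u
  refine le_of_sq_le_sq (h.trans_eq (by ring)) (by positivity)

theorem integral_mul_partialDeriv_partialDeriv_sq_le
    (u : Fin 2 → SchwartzMap (EuclideanSpace ℝ (Fin 2)) ℝ) (i j k : Fin 2) :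
    ∫ x, (u j x * ((u k).partialDeriv j).partialDeriv i x) ^ 2 ≤
      (1 / 128) * derivNormSq 3 u +
        8192 * (derivNormSq 0 u * derivNormSq 1 u * derivNormSq 2 u) := by
  have h := (u j).sq_integral_sq_mul_sq_le_of_le (((u k).partialDeriv j).partialDeriv i)
    (integral_sq_le_derivNormSq u j)
    (fun l => integral_partialDeriv_sq_le_derivNormSq u j l)
    (integral_partialDeriv_partialDeriv_sq_le_derivNormSq u k i j)
    (fun l => integral_partialDeriv_partialDeriv_partialDeriv_sq_le_derivNormSq u k l i j)
  have h0 := derivNormSq_nonneg 0 u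
  have h1 := derivNormSq_nonneg 1 u
  have h2 := derivNormSq_nonneg 2 u
  have h3 := derivNormSq_nonneg 3 u
  refine le_of_sq_le_sq (h.trans ?_) (by positivity)
  nlinarith [sq_nonneg ((1 / 128) * derivNormSq 3 u -
    8192 * (derivNormSq 0 u * derivNormSq 1 u * derivNormSq 2 u))]

theorem fderiv_advection_eq_sum (u : Fin 2 → SchwartzMap (EuclideanSpace ℝ (Fin 2)) ℝ)
    (i k : Fin 2) (x : EuclideanSpace ℝ (Fin 2)) :
    fderiv ℝ (fun y => ∑ j, u j y *
      fderiv ℝ (fun z => u k z) y (EuclideanSpace.single j 1)) x (EuclideanSpace.single i 1) =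
      ∑ j, ((u j).partialDeriv i x * (u k).partialDeriv j x +
        u j x * ((u k).partialDeriv j).partialDeriv i x) := by
  have h : (fun y => ∑ j, u j y *
      fderiv ℝ (fun z => u k z) y (EuclideanSpace.single j 1)) =
      fun y => ∑ j, ((u j).prod ((u k).partialDeriv j)) y := by
    funext y
    simp [lineDerivOp_apply_eq_fderiv]
  rw [h, fderiv_fun_sum fun j _ => SchwartzMap.differentiableAt _, sum_apply]
  refine Finset.sum_congr rfl fun j _ => ?_
  rw [← partialDeriv_prod, ← lineDerivOp_apply_eq_fderiv]

theorem integral_sq_fderiv_advection_le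
    (u : Fin 2 → SchwartzMap (EuclideanSpace ℝ (Fin 2)) ℝ) :
    (∫ x, ∑ i, ∑ k, (fderiv ℝ (fun y => ∑ j, u j y *
      fderiv ℝ (fun z => u k z) y (EuclideanSpace.single j 1)) x
        (EuclideanSpace.single i 1)) ^ 2) ≤
      ∑ i, ∑ k, ∑ j, 4 * ((∫ x, ((u j).partialDeriv i x * (u k).partialDeriv j x) ^ 2) +
        ∫ x, (u j x * ((u k).partialDeriv j).partialDeriv i x) ^ 2) := by
  have hi : ∀ f g : SchwartzMap (EuclideanSpace ℝ (Fin 2)) ℝ,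
      Integrable fun x => (f x * g x) ^ 2 := fun f g => by
    simpa using ((f.prod g).memLp 2 volume).integrable_sq
  have hj : ∀ i k j, Integrable fun x =>
      4 * (((u j).partialDeriv i x * (u k).partialDeriv j x) ^ 2 +
        (u j x * ((u k).partialDeriv j).partialDeriv i x) ^ 2) :=
    fun i k j => ((hi _ _).add (hi _ _)).const_mul 4
  have hsum : Integrable fun x => ∑ i, ∑ k, ∑ j,
      4 * (((u j).partialDeriv i x * (u k).partialDeriv j x) ^ 2 +
        (u j x * ((u k).partialDeriv j).partialDeriv i x) ^ 2) :=
    integrable_finsetSum _ fun i _ => integrable_finsetSum _ fun k _ =>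
      integrable_finsetSum _ fun j _ => hj i k j
  calc _ ≤ ∫ x, ∑ i, ∑ k, ∑ j,
        4 * (((u j).partialDeriv i x * (u k).partialDeriv j x) ^ 2 +
          (u j x * ((u k).partialDeriv j).partialDeriv i x) ^ 2) := by
        refine integral_mono_of_nonneg (.of_forall fun x => by positivity) hsum
          (.of_forall fun x => ?_)
        refine Finset.sum_le_sum fun i _ => Finset.sum_le_sum fun k _ => ?_
        rw [fderiv_advection_eq_sum]
        refine (sq_sum_le_card_mul_sum_sq (s := Finset.univ)).trans ?_
        rw [Finset.mul_sum]
        refine Finset.sum_le_sum fun j _ => ?_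
        have := add_sq_le (a := (u j).partialDeriv i x * (u k).partialDeriv j x)
          (b := u j x * ((u k).partialDeriv j).partialDeriv i x)
        simp only [Finset.card_univ, Fintype.card_fin, Nat.cast_ofNat]
        linarith
    _ = _ := by
        rw [integral_finsetSum _ fun i _ => integrable_finsetSum _ fun k _ =>
          integrable_finsetSum _ fun j _ => hj i k j]
        refine Finset.sum_congr rfl fun i _ => ?_
        rw [integral_finsetSum _ fun k _ => integrable_finsetSum _ fun j _ => hj i k j]
        refine Finset.sum_congr rfl fun k _ => ?_
        rw [integral_finsetSum _ fun j _ => hj i k j]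
        refine Finset.sum_congr rfl fun j _ => ?_
        rw [integral_const_mul, integral_add (hi _ _) (hi _ _)]

end

/-- Estimate `‖∇((u·∇)u)‖₀² ≤ ¼‖u‖₃² + C‖u‖₂²‖u‖₁²(1+‖u‖₀²)` from the proof of
Lemma 7.1 for the 2D Navier–Stokes nonlinearity. -/
theorem stmt12 :
    ∃ C : ℝ, 0 < C ∧ ∀ u : Fin 2 → SchwartzMap (EuclideanSpace ℝ (Fin 2)) ℝ,
      (∫ x, ∑ i, ∑ k,
          (fderiv ℝ (fun y => ∑ i', u i' y *
              fderiv ℝ (fun z => u k z) y (EuclideanSpace.single i' 1)) x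
            (EuclideanSpace.single i 1)) ^ 2) ≤
        (1 / 4) * sobNormSq 2 3 u +
          C * sobNormSq 2 2 u * sobNormSq 2 1 u * (1 + sobNormSq 2 0 u) := by
  refine ⟨262144, by norm_num, fun u => (integral_sq_fderiv_advection_le u).trans ?_⟩
  have h0 := derivNormSq_nonneg 0 u
  have h1 := derivNormSq_nonneg 1 u
  have h2 := derivNormSq_nonneg 2 u
  have s0 := derivNormSq_le_sobNormSq 0 u
  have s1 := derivNormSq_le_sobNormSq 1 u
  have s2 := derivNormSq_le_sobNormSq 2 u
  have s3 := derivNormSq_le_sobNormSq 3 u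
  calc _ ≤ ∑ _i : Fin 2, ∑ _k : Fin 2, ∑ _j : Fin 2,
        4 * (16 * (derivNormSq 1 u * derivNormSq 2 u) + ((1 / 128) * derivNormSq 3 u +
          8192 * (derivNormSq 0 u * derivNormSq 1 u * derivNormSq 2 u))) := by
        gcongr with i _ k _ j _
        · exact integral_mul_partialDeriv_sq_le u i j k
        · exact integral_mul_partialDeriv_partialDeriv_sq_le u i j k
    _ = (1 / 4) * derivNormSq 3 u + 512 * (derivNormSq 1 u * derivNormSq 2 u) +
          262144 * (derivNormSq 0 u * derivNormSq 1 u * derivNormSq 2 u) := by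
        simp
        ring
    _ ≤ (1 / 4) * derivNormSq 3 u + 262144 * (derivNormSq 1 u * derivNormSq 2 u) +
          262144 * (derivNormSq 0 u * derivNormSq 1 u * derivNormSq 2 u) := by
        gcongr
        norm_num
    _ = (1 / 4) * derivNormSq 3 u + 262144 * derivNormSq 2 u * derivNormSq 1 u *
          (1 + derivNormSq 0 u) := by ring
    _ ≤ _ := by
        have := h1.trans s1
        have := h2.trans s2
        gcongr
end

section
/- Let κ ≥ 0 and let g : ℝ → ℝ be continuously differentiable with 0 ≤ g(r) ≤ r and |g′(r)| ≤ κ for all r ≥ 0. Then for every Schwartz vector field u : ℝ² → ℝ², ∫_{ℝ²} ∑_{i,k=1}^2 ( ∂_{x_i}[ g(|u(x)|²) u_k(x) ] )² dx ≤ (1 + 2κ)² (sup_{x∈ℝ²} |u(x)|)⁴ ∫_{ℝ²} |∇u(x)|² dx. (This is the estimate ‖∇(g_N(|u|²)u)‖₀² ≤ C‖u‖_{L^∞}⁴‖u‖₁² established in the proof of Lemma 7.1 for the taming term, uniformly in the taming parameter N; the taming function g_N of (6.4) satisfies the stated hypotheses.) -/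
open MeasureTheory

/-- Bound on the squared length of `G • a + 2 D (v ⬝ a) • v` when `0 ≤ G ≤ |v|²` and `|D| ≤ κ`. -/
theorem sum_sq_taming_le {ι : Type*} [Fintype ι] (v a : ι → ℝ) {G D κ : ℝ}
    (hG : 0 ≤ G) (hGv : G ≤ ∑ j, v j ^ 2) (hD : |D| ≤ κ) :
    ∑ k, (G * a k + 2 * D * (∑ j, v j * a j) * v k) ^ 2 ≤
      (1 + 2 * κ) ^ 2 * (∑ j, v j ^ 2) ^ 2 * ∑ k, a k ^ 2 := by
  have hcs := Finset.sum_mul_sq_le_sq_mul_sq Finset.univ v a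
  have hexp : ∑ k, (G * a k + 2 * D * (∑ j, v j * a j) * v k) ^ 2 =
      G ^ 2 * (∑ k, a k ^ 2) + 4 * (G * D) * (∑ j, v j * a j) ^ 2 +
        4 * D ^ 2 * (∑ j, v j * a j) ^ 2 * ∑ j, v j ^ 2 := by
    generalize hP : ∑ j, v j * a j = P
    have hterm : ∀ k, (G * a k + 2 * D * P * v k) ^ 2 =
        G ^ 2 * a k ^ 2 + 4 * G * D * P * (v k * a k) + 4 * D ^ 2 * P ^ 2 * v k ^ 2 :=
      fun k => by ring
    simp only [hterm, Finset.sum_add_distrib, ← Finset.mul_sum, hP]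
    ring
  rw [hexp]
  have hA : 0 ≤ ∑ k, a k ^ 2 := Finset.sum_nonneg fun k _ => sq_nonneg _
  have hκ : 0 ≤ κ := (abs_nonneg D).trans hD
  have hS : 0 ≤ ∑ j, v j ^ 2 := hG.trans hGv
  have hQ : 0 ≤ (∑ j, v j * a j) ^ 2 := sq_nonneg _
  generalize (∑ j, v j * a j) ^ 2 = Q at *
  generalize ∑ j, v j ^ 2 = S at *
  generalize ∑ k, a k ^ 2 = A at *
  have hG2 : G ^ 2 * A ≤ S ^ 2 * A := by gcongr
  have hGD : G * D ≤ S * κ := by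
    calc G * D ≤ G * κ := by gcongr; exact (le_abs_self D).trans hD
      _ ≤ S * κ := by gcongr
  have hcross : 4 * (G * D) * Q ≤ 4 * (S * κ) * (S * A) := by gcongr
  have hD2 : D ^ 2 ≤ κ ^ 2 := sq_le_sq' (neg_le_of_abs_le hD) (le_of_abs_le hD)
  have hlast : 4 * D ^ 2 * Q * S ≤ 4 * κ ^ 2 * (S * A) * S := by gcongr
  nlinarith

/-- Directional derivatives of Schwartz functions are square-integrable. -/
theorem SchwartzMap.integrable_fderiv_apply_sq {E : Type*} [NormedAddCommGroup E]
    [NormedSpace ℝ E] [MeasurableSpace E] [BorelSpace E] [SecondCountableTopology E]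
    (μ : Measure E) [μ.HasTemperateGrowth] (f : SchwartzMap E ℝ) (m : E) :
    Integrable (fun x => (fderiv ℝ (fun z => f z) x m) ^ 2) μ := by
  have h := ((LineDeriv.lineDerivOp m f : SchwartzMap E ℝ).memLp 2 μ).integrable_sq
  simpa [SchwartzMap.lineDerivOp_apply_eq_fderiv] using h

/-- The Euclidean length of a Schwartz vector field is bounded. -/
theorem SchwartzMap.bddAbove_range_sqrt_sum_sq {E ι : Type*} [NormedAddCommGroup E]
    [NormedSpace ℝ E] [Fintype ι] (u : ι → SchwartzMap E ℝ) :
    BddAbove (Set.range fun x => Real.sqrt (∑ j, (u j x) ^ 2)) := by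
  refine ⟨Real.sqrt (∑ j, (SchwartzMap.seminorm ℝ 0 0 (u j)) ^ 2), ?_⟩
  rintro _ ⟨x, rfl⟩
  refine Real.sqrt_le_sqrt (Finset.sum_le_sum fun j _ => ?_)
  rw [← sq_abs (u j x)]
  exact pow_le_pow_left₀ (abs_nonneg _) (SchwartzMap.norm_le_seminorm ℝ (u j) x) 2

/-- Directional derivative of the taming term `g(|u|²) u_k`. -/
theorem fderiv_taming_apply {E ι : Type*} [NormedAddCommGroup E] [NormedSpace ℝ E] [Fintype ι]
    {g : ℝ → ℝ} (hg : Differentiable ℝ g) {u : ι → E → ℝ} {x : E}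
    (hu : ∀ j, DifferentiableAt ℝ (u j) x) (k : ι) (m : E) :
    fderiv ℝ (fun y => g (∑ j, (u j y) ^ 2) * u k y) x m =
      g (∑ j, (u j x) ^ 2) * fderiv ℝ (u k) x m +
        2 * deriv g (∑ j, (u j x) ^ 2) * (∑ j, u j x * fderiv ℝ (u j) x m) * u k x := by
  have hs : HasFDerivAt (fun y => ∑ j, (u j y) ^ 2)
      (∑ j, (2 * u j x) • fderiv ℝ (u j) x) x :=
    HasFDerivAt.fun_sum fun j _ => by simpa using (hu j).hasFDerivAt.pow 2
  have h := ((hg _).hasDerivAt.comp_hasFDerivAt x hs).mul (hu k).hasFDerivAt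
  have h' := congrArg (fun L : E →L[ℝ] ℝ => L m) h.fderiv
  refine h'.trans ?_
  simp only [Function.comp_apply, add_apply, smul_apply,
    sum_apply, smul_eq_mul, mul_assoc, ← Finset.mul_sum]
  ring

/-- Estimate `‖∇(g_N(|u|²)u)‖₀² ≤ (1+2κ)² ‖u‖_{L^∞}⁴ ‖∇u‖₀²` from the proof of Lemma 7.1
for the taming term, uniformly in the taming parameter: for `g ∈ C¹(ℝ)` with
`0 ≤ g(r) ≤ r` on `r ≥ 0` and `|g′| ≤ κ` on `r ≥ 0`, and a Schwartz vector field
`u : ℝ² → ℝ²`. -/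
theorem stmt14 (κ : ℝ) (hκ : 0 ≤ κ) (g : ℝ → ℝ) (hg : ContDiff ℝ 1 g)
    (hg0 : ∀ r : ℝ, 0 ≤ r → 0 ≤ g r ∧ g r ≤ r)
    (hg' : ∀ r : ℝ, 0 ≤ r → |deriv g r| ≤ κ)
    (u : Fin 2 → SchwartzMap (EuclideanSpace ℝ (Fin 2)) ℝ) :
    (∫ x, ∑ i, ∑ k,
        (fderiv ℝ (fun y => g (∑ j, (u j y) ^ 2) * u k y) x
          (EuclideanSpace.single i 1)) ^ 2) ≤
      (1 + 2 * κ) ^ 2 * (⨆ x, Real.sqrt (∑ j, (u j x) ^ 2)) ^ 4 *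
        ∫ x, ∑ i, ∑ k, (fderiv ℝ (fun z => u k z) x (EuclideanSpace.single i 1)) ^ 2 := by
  rw [← integral_const_mul]
  refine integral_mono_of_nonneg (.of_forall fun x => by positivity)
    (Integrable.const_mul (integrable_finsetSum _ fun i _ => integrable_finsetSum _ fun k _ =>
      (u k).integrable_fderiv_apply_sq _ _) _) (.of_forall fun x => ?_)
  have hS : 0 ≤ ∑ j, (u j x) ^ 2 := Finset.sum_nonneg fun j _ => sq_nonneg _
  have hsup : (∑ j, (u j x) ^ 2) ^ 2 ≤ (⨆ x, Real.sqrt (∑ j, (u j x) ^ 2)) ^ 4 := by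
    calc (∑ j, (u j x) ^ 2) ^ 2 = Real.sqrt (∑ j, (u j x) ^ 2) ^ 4 := by
          rw [show 4 = 2 * 2 from rfl, pow_mul, Real.sq_sqrt hS]
      _ ≤ _ := pow_le_pow_left₀ (Real.sqrt_nonneg _)
          (le_ciSup (SchwartzMap.bddAbove_range_sqrt_sum_sq u) x) 4
  simp only [Finset.mul_sum (s := Finset.univ (α := Fin 2)) (f := fun i => ∑ k, _)]
  refine Finset.sum_le_sum fun i _ => ?_
  simp only [fderiv_taming_apply (hg.differentiable one_ne_zero)
    (fun j => (u j).differentiableAt)]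
  refine (sum_sq_taming_le (fun j => u j x) _ (hg0 _ hS).1 (hg0 _ hS).2 (hg' _ hS)).trans ?_
  gcongr
end
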